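/- arXiv:2510.17317 — 5 statements merged into one kernel-verified Lean document; each statement's English description precedes it below -/
import Mathlib

section
/- (Annihilator of the cocycle group is the boundary group.) For a chain k ∈ C_p(Ĝ), one has ⟨k, φ⟩ = 0 in ℝ/2πℤ for every cocycle φ ∈ Z^p(G) if and only if k ∈ B_p(Ĝ), i.e. there exists k' ∈ C_{p+1}(Ĝ) with ∂k' = k. -/
open Finset

noncomputable section

/-- The Pontryagin dual `Ĝ = Hom(G, ℝ/2πℤ)` of an abelian group `G`,
where `ℝ/2πℤ` is `Real.Angle = AddCircle (2π)`. -/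
abbrev PDual (G : Type) [AddCommGroup G] : Type := G →+ Real.Angle

variable {G : Type} [AddCommGroup G]

/-- The pairing `⟨k, φ⟩ = ∑_{σ ∈ Δ} k(σ)(φ(σ))` with values in `ℝ/2πℤ`. -/
def pairing {Δ : Type} [Fintype Δ] (k : Δ → PDual G) (φ : Δ → G) : Real.Angle :=
  ∑ σ, k σ (φ σ)

/-- The boundary map `∂` on chains with coefficients in the dual group:
`(∂k')(σ) = ∑_τ s(τ,σ) • k'(τ)`. -/
def bd {A B : Type} [Fintype A] (s : A → B → ℤ) (k' : A → PDual G) : B → PDual G :=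
  fun σ => ∑ τ, s τ σ • k' τ

/-- The coboundary map `δ` on cochains with coefficients in `G`:
`(δφ)(τ) = ∑_σ s(τ,σ) • φ(σ)`. -/
def cb {A B : Type} [Fintype B] (s : A → B → ℤ) (φ : B → G) : A → G :=
  fun τ => ∑ σ, s τ σ • φ σ


theorem angle_baer : Module.Baer ℤ Real.Angle := by
  haveI : Fact ((0 : ℝ) < 2 * Real.pi) := ⟨Real.two_pi_pos⟩
  haveI : DivisibleBy Real.Angle ℤ :=
    inferInstanceAs (DivisibleBy (AddCircle (2 * Real.pi)) ℤ)
  exact Module.Baer.of_divisible Real.Angle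

theorem exists_factor {M N : Type} [AddCommGroup M] [AddCommGroup N] (f : M →+ N)
    (g : M →+ Real.Angle) (h : ∀ x, f x = 0 → g x = 0) :
    ∃ l : N →+ Real.Angle, ∀ x, l (f x) = g x := by
  obtain ⟨l, hl⟩ := angle_baer.extension_property_addMonoidHom (QuotientAddGroup.kerLift f)
    (QuotientAddGroup.kerLift_injective f) (QuotientAddGroup.lift f.ker g (fun x hx => h x hx))
  exact ⟨l, fun x => DFunLike.congr_fun hl (QuotientAddGroup.mk x)⟩

theorem pairing_bd {G : Type} [AddCommGroup G] {A B : Type} [Fintype A] [Fintype B]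
    (s : A → B → ℤ) (k' : A → PDual G) (φ : B → G) :
    pairing (bd s k') φ = pairing k' (cb s φ) := by
  simp only [pairing, bd, cb, map_sum, map_zsmul, AddMonoidHom.finsetSum_apply,
    AddMonoidHom.coe_smul, Pi.smul_apply]
  exact Finset.sum_comm

/-- **Annihilator of the cocycle group is the boundary group**: a chain
`k ∈ C_p(Ĝ)` pairs to zero with every cocycle `φ ∈ Z^p(G) = ker δ` if and only
if `k ∈ B_p(Ĝ) = im ∂`, i.e. there is `k' ∈ C_{p+1}(Ĝ)` with `∂k' = k`. -/
theorem annihilator_of_cocycles_eq_boundaries {G : Type} [AddCommGroup G] [Fintype G]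
    {Δp Δp1 : Type} [Fintype Δp] [Fintype Δp1] (s : Δp1 → Δp → ℤ)
    (k : Δp → PDual G) :
    (∀ φ : Δp → G, cb s φ = 0 → pairing k φ = 0) ↔
      ∃ k' : Δp1 → PDual G, bd s k' = k := by
  classical
  constructor
  · intro h
    let f : (Δp → G) →+ (Δp1 → G) :=
      AddMonoidHom.mk' (cb s) (fun a b => by
        funext τ; simp [cb, smul_add, Finset.sum_add_distrib])
    let g : (Δp → G) →+ Real.Angle :=
      AddMonoidHom.mk' (pairing k) (fun a b => by
        simp [pairing, Finset.sum_add_distrib])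
    obtain ⟨l, hl⟩ := exists_factor f g h
    refine ⟨fun τ => l.comp (AddMonoidHom.single (fun _ => G) τ), ?_⟩
    have key : ∀ ψ : Δp1 → G,
        pairing (fun τ => l.comp (AddMonoidHom.single (fun _ => G) τ)) ψ = l ψ := by
      intro ψ
      simp only [pairing, AddMonoidHom.comp_apply, AddMonoidHom.single_apply]
      rw [← map_sum, Finset.univ_sum_single]
    have single : ∀ (c : Δp → PDual G) (σ : Δp) (x : G),
        pairing c (Pi.single σ x) = c σ x := by
      intro c σ x
      unfold pairing
      rw [Finset.sum_eq_single σ]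
      · simp
      · intro b _ hb
        simp [Pi.single_eq_of_ne hb]
      · simp
    funext σ
    ext x
    rw [← single, ← single, pairing_bd, key]
    exact hl _
  · rintro ⟨k', rfl⟩ φ hφ
    rw [pairing_bd, hφ]
    simp [pairing]
end
end

section
/- (Annihilator of the cycle group is the coboundary group.) For a cochain φ' ∈ C^{p+1}(G), one has ⟨k', φ'⟩ = 0 in ℝ/2πℤ for every cycle k' ∈ Z_{p+1}(Ĝ) if and only if φ' ∈ B^{p+1}(G), i.e. there exists φ ∈ C^p(G) with δφ = φ'. -/
open Finset

noncomputable section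

variable {G : Type} [AddCommGroup G]

theorem exists_angle_embedding :
    ∃ j : AddCircle (1 : ℚ) →+ Real.Angle, ∀ x, j x = 0 → x = 0 := by
  let f : ℚ →+ Real.Angle :=
    { toFun := fun q => ((2 * Real.pi * (q : ℝ) : ℝ) : Real.Angle)
      map_zero' := by simp
      map_add' := fun a b => by
        rw [← Real.Angle.coe_add]; push_cast; rw [mul_add] }
  have hf : ∀ q : ℚ, f q = 0 ↔ q ∈ AddSubgroup.zmultiples (1 : ℚ) := by
    intro q
    change ((2 * Real.pi * (q : ℝ) : ℝ) : Real.Angle) = 0 ↔ _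
    rw [← Real.Angle.coe_zero, Real.Angle.angle_eq_iff_two_pi_dvd_sub,
      AddSubgroup.mem_zmultiples_iff]
    refine exists_congr fun k => ?_
    have hpi : (2 * Real.pi) ≠ 0 := by positivity
    rw [sub_zero, mul_right_inj' hpi]
    simp only [zsmul_eq_mul, mul_one]
    constructor
    · intro h; exact_mod_cast h.symm
    · intro h; exact_mod_cast h.symm
  refine ⟨QuotientAddGroup.lift (AddSubgroup.zmultiples (1 : ℚ)) f
    (fun q hq => (hf q).2 hq), ?_⟩
  intro x
  induction x using QuotientAddGroup.induction_on with
  | H q =>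
    intro h
    exact (QuotientAddGroup.eq_zero_iff q).2 ((hf q).1 h)

/-- **Annihilator of the cycle group is the coboundary group**: a cochain
`φ' ∈ C^{p+1}(G)` pairs to zero with every cycle `k' ∈ Z_{p+1}(Ĝ) = ker ∂` if
and only if `φ' ∈ B^{p+1}(G) = im δ`, i.e. there is `φ ∈ C^p(G)` with `δφ = φ'`. -/
theorem annihilator_of_cycles_eq_coboundaries {G : Type} [AddCommGroup G] [Fintype G]
    {Δp Δp1 : Type} [Fintype Δp] [Fintype Δp1] (s : Δp1 → Δp → ℤ)
    (φ' : Δp1 → G) :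
    (∀ k' : Δp1 → PDual G, bd s k' = 0 → pairing k' φ' = 0) ↔
      ∃ φ : Δp → G, cb s φ = φ' := by
  classical
  constructor
  · intro h
    let D : (Δp → G) →+ (Δp1 → G) :=
      { toFun := cb s
        map_zero' := by ext τ; simp [cb]
        map_add' := fun a b => by ext τ; simp [cb, Finset.sum_add_distrib] }
    suffices hm : φ' ∈ D.range from hm
    by_contra hn
    have hne : (QuotientAddGroup.mk φ' : (Δp1 → G) ⧸ D.range) ≠ 0 := fun h0 =>
      hn ((QuotientAddGroup.eq_zero_iff φ').1 h0)
    obtain ⟨c, hc⟩ := CharacterModule.exists_character_apply_ne_zero_of_ne_zero hne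
    obtain ⟨j, hj⟩ := exists_angle_embedding
    let c' : ((Δp1 → G) ⧸ D.range) →+ AddCircle (1 : ℚ) := c
    let ψ : (Δp1 → G) →+ Real.Angle := (j.comp c').comp (QuotientAddGroup.mk' D.range)
    have hψD : ∀ φ, ψ (cb s φ) = 0 := by
      intro φ
      have : (QuotientAddGroup.mk (cb s φ) : (Δp1 → G) ⧸ D.range) = 0 :=
        (QuotientAddGroup.eq_zero_iff _).2 ⟨φ, rfl⟩
      change j (c' (QuotientAddGroup.mk (cb s φ))) = 0
      rw [this, map_zero, map_zero]
    apply hc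
    apply hj
    change ψ φ' = 0
    have key := h (fun τ => ψ.comp (AddMonoidHom.single (fun _ : Δp1 => G) τ)) ?_
    · rw [← Finset.univ_sum_single φ', map_sum]
      exact key
    · ext σ g
      have e : cb s (Pi.single σ g) = ∑ τ, s τ σ • (Pi.single τ g : Δp1 → G) := by
        ext τ
        simp [cb, Finset.sum_apply, Pi.single_apply]
      have := hψD (Pi.single σ g)
      rw [e, map_sum] at this
      simpa [bd, AddMonoidHom.finsetSum_apply] using this
  · rintro ⟨φ, rfl⟩ k' hk
    have : pairing k' (cb s φ) = pairing (bd s k') φ := by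
      simp only [pairing, cb, bd, map_sum, map_zsmul, AddMonoidHom.finsetSum_apply]
      rw [Finset.sum_comm]
      rfl
    rw [this, hk]
    simp [pairing]
end
end

section
/- (Cardinality identity for cycles and cocycles.) The finite groups Z_{p+1}(Ĝ) and Z^p(G) satisfy |Z_{p+1}(Ĝ)| · |G|^{|Δ^p|} = |Z^p(G)| · |G|^{|Δ^{p+1}|}; equivalently, |Z_{p+1}(Ĝ)| / |Z^p(G)| = |G|^{|Δ^{p+1}| − |Δ^p|}. -/
open Finset

noncomputable section

variable {G : Type} [AddCommGroup G]

theorem card_pdual (A : Type) [AddCommGroup A] [Finite A] :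
    Nat.card (A →+ Real.Angle) = Nat.card A := by
  classical
  cases nonempty_fintype A
  let e : Real.Angle ≃+ Additive Circle :=
    { toFun := fun x => Additive.ofMul x.toCircle
      invFun := fun x => AddCircle.homeomorphCircle'.symm x.toMul
      left_inv := fun x => AddCircle.homeomorphCircle'.symm_apply_apply x
      right_inv := fun x => AddCircle.homeomorphCircle'.apply_symm_apply x.toMul
      map_add' := fun x y => Real.Angle.toCircle_add x y }
  let e1 : (A →+ Real.Angle) ≃ (A →+ Additive Circle) :=
    { toFun := fun f => e.toAddMonoidHom.comp f
      invFun := fun f => e.symm.toAddMonoidHom.comp f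
      left_inv := fun f => by ext x; simp
      right_inv := fun f => by ext x; simp }
  rw [Nat.card_congr (e1.trans (AddChar.toAddMonoidHomEquiv.symm.trans
    AddChar.circleEquivComplex.toEquiv)), Nat.card_eq_fintype_card, AddChar.card_eq,
    Nat.card_eq_fintype_card]

/-- The coboundary as a homomorphism. -/
def cbHom {A B : Type} [Fintype B] {G : Type} [AddCommGroup G] (s : A → B → ℤ) :
    (B → G) →+ (A → G) where
  toFun := cb s
  map_zero' := by ext; simp [cb]
  map_add' x y := by ext; simp [cb, Finset.sum_add_distrib]

/-- The pairing with a fixed chain, as a homomorphism. -/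
def pairHom {A : Type} [Fintype A] {G : Type} [AddCommGroup G] (k : A → PDual G) :
    (A → G) →+ Real.Angle where
  toFun := pairing k
  map_zero' := by simp [pairing]
  map_add' x y := by simp [pairing, Finset.sum_add_distrib]

theorem pairing_cb {A B : Type} [Fintype A] [Fintype B] {G : Type} [AddCommGroup G]
    (s : A → B → ℤ) (k : A → PDual G) (φ : B → G) :
    pairing k (cb s φ) = pairing (bd s k) φ := by
  simp only [pairing, cb, bd, map_sum, map_zsmul, AddMonoidHom.finsetSum_apply,
    AddMonoidHom.zsmul_apply]
  exact Finset.sum_comm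

theorem pairing_single {A : Type} [Fintype A] [DecidableEq A] {G : Type} [AddCommGroup G]
    (k : A → PDual G) (a : A) (g : G) :
    pairing k (Pi.single a g) = k a g := by
  unfold pairing
  rw [Finset.sum_eq_single a]
  · simp
  · intro b _ hb
    simp [hb]
  · simp

theorem card_cycles {A B : Type} [Fintype A] [Fintype B] {G : Type} [AddCommGroup G]
    (s : A → B → ℤ) :
    Nat.card {k' : A → PDual G // bd s k' = 0} =
      Nat.card (((A → G) ⧸ (cbHom (G := G) s).range) →+ Real.Angle) := by
  classical
  refine Nat.card_congr
    { toFun := fun k => QuotientAddGroup.lift _ (pairHom k.1) ?_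
      invFun := fun f => ⟨fun a => (f.comp (QuotientAddGroup.mk' _)).comp
        (AddMonoidHom.single (fun _ : A => G) a), ?_⟩
      left_inv := ?_
      right_inv := ?_ }
  · rintro _ ⟨φ, rfl⟩
    change pairing k.1 (cb s φ) = 0
    rw [pairing_cb, k.2]
    simp [pairing]
  · have key : ∀ x, pairing (fun a => (f.comp (QuotientAddGroup.mk' _)).comp
        (AddMonoidHom.single (fun _ : A => G) a)) x = f (QuotientAddGroup.mk' _ x) := by
      intro x
      conv_rhs => rw [← Finset.univ_sum_single x]
      simp only [map_sum]
      rfl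
    ext b g
    rw [← pairing_single, ← pairing_cb, key]
    have : QuotientAddGroup.mk' (cbHom (G := G) s).range (cb s (Pi.single b g)) = 0 :=
      (QuotientAddGroup.eq_zero_iff _).2 ⟨Pi.single b g, rfl⟩
    rw [this]
    simp
  · intro k
    ext a g
    exact pairing_single k.1 a g
  · intro f
    ext a g
    exact pairing_single _ a g

/-- **Cardinality identity for cycles and cocycles**:
`|Z_{p+1}(Ĝ)| ⬝ |G|^{|Δ^p|} = |Z^p(G)| ⬝ |G|^{|Δ^{p+1}|}`, i.e.
`|Z_{p+1}(Ĝ)| / |Z^p(G)| = |G|^{|Δ^{p+1}| − |Δ^p|}`. -/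
theorem card_cycles_div_card_cocycles {G : Type} [AddCommGroup G] [Fintype G]
    {Δp Δp1 : Type} [Fintype Δp] [Fintype Δp1] (s : Δp1 → Δp → ℤ) :
    Nat.card {k' : Δp1 → PDual G // bd s k' = 0} * (Fintype.card G) ^ (Fintype.card Δp)
      = Nat.card {φ : Δp → G // cb s φ = 0} * (Fintype.card G) ^ (Fintype.card Δp1) := by
  have h1 := AddSubgroup.card_eq_card_quotient_mul_card_addSubgroup (cbHom (G := G) s).range
  have h2 := AddSubgroup.card_eq_card_quotient_mul_card_addSubgroup (cbHom (G := G) s).ker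
  rw [Nat.card_congr (QuotientAddGroup.quotientKerEquivRange (cbHom (G := G) s)).toEquiv] at h2
  have h3 : Nat.card (cbHom (G := G) s).ker = Nat.card {φ : Δp → G // cb s φ = 0} := rfl
  rw [h3] at h2
  rw [card_cycles, card_pdual]
  rw [Nat.card_fun, Nat.card_eq_fintype_card, Nat.card_eq_fintype_card] at h1 h2
  rw [h1, h2]
  ring
end
end

section
/- For every finitely generated abelian group M and every finite abelian group G, the groups Hom(M, G) and M ⊗_ℤ G are finite and have the same cardinality: |Hom(M, G)| = |M ⊗_ℤ G|. -/
open TensorProduct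

def HomTensorCard (R : Type) [CommRing R] (G : Type) [AddCommGroup G] [Module R G] (M : Type) [AddCommGroup M] [Module R M] : Prop :=
  Finite (M →ₗ[R] G) ∧ Finite (M ⊗[R] G) ∧ Nat.card (M →ₗ[R] G) = Nat.card (M ⊗[R] G)

section
variable {R : Type} [CommRing R] {G : Type} [AddCommGroup G] [Module R G]

theorem HomTensorCard.congr {M N : Type} [AddCommGroup M] [Module R M] [AddCommGroup N]
    [Module R N] (e : M ≃ₗ[R] N) (h : HomTensorCard R G M) : HomTensorCard R G N := by
  obtain ⟨h1, h2, h3⟩ := h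
  let e1 : (M →ₗ[R] G) ≃ (N →ₗ[R] G) := (LinearEquiv.congrLeft G R e).toEquiv
  let e2 : (M ⊗[R] G) ≃ (N ⊗[R] G) := (TensorProduct.congr e (LinearEquiv.refl R G)).toEquiv
  exact ⟨Finite.of_equiv _ e1, Finite.of_equiv _ e2, by
    rw [← Nat.card_congr e1, ← Nat.card_congr e2, h3]⟩

theorem HomTensorCard.prod {M N : Type} [AddCommGroup M] [Module R M] [AddCommGroup N]
    [Module R N] (h : HomTensorCard R G M) (h' : HomTensorCard R G N) :
    HomTensorCard R G (M × N) := by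
  obtain ⟨h1, h2, h3⟩ := h
  obtain ⟨h1', h2', h3'⟩ := h'
  let e1 : ((M →ₗ[R] G) × (N →ₗ[R] G)) ≃ (M × N →ₗ[R] G) := (LinearMap.coprodEquiv R).toEquiv
  let e2 := (TensorProduct.prodLeft R R M N G).toEquiv
  exact ⟨Finite.of_equiv _ e1, Finite.of_equiv _ e2.symm, by
    rw [← Nat.card_congr e1, Nat.card_congr e2, Nat.card_prod, Nat.card_prod, h3, h3']⟩

theorem HomTensorCard.pi {ι : Type} [Fintype ι] {M : ι → Type} [∀ i, AddCommGroup (M i)]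
    [∀ i, Module R (M i)] (h : ∀ i, HomTensorCard R G (M i)) :
    HomTensorCard R G (∀ i, M i) := by
  classical
  have h1 := fun i => (h i).1
  have h2 := fun i => (h i).2.1
  have h3 := fun i => (h i).2.2
  let e1 : (∀ i, M i →ₗ[R] G) ≃ ((∀ i, M i) →ₗ[R] G) := (LinearMap.lsum R M R).toEquiv
  let e2 : ((∀ i, M i) ⊗[R] G) ≃ (∀ i, M i ⊗[R] G) :=
    (TensorProduct.comm .. ≪≫ₗ TensorProduct.piRight R R G M ≪≫ₗ
      .piCongrRight fun _ ↦ TensorProduct.comm ..).toEquiv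
  exact ⟨Finite.of_equiv _ e1, Finite.of_equiv _ e2.symm, by
    rw [← Nat.card_congr e1, Nat.card_congr e2, Nat.card_pi, Nat.card_pi]
    simp only [h3]⟩

theorem HomTensorCard.int [Finite G] : HomTensorCard R G R := by
  let e1 : (R →ₗ[R] G) ≃ G := (LinearMap.ringLmapEquivSelf R R G).toEquiv
  let e2 : (R ⊗[R] G) ≃ G := (TensorProduct.lid R G).toEquiv
  exact ⟨Finite.of_equiv _ e1.symm, Finite.of_equiv _ e2.symm, by
    rw [Nat.card_congr e1, Nat.card_congr e2]⟩

open scoped Pointwise in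
theorem HomTensorCard.cyclic [Finite G] (a : R) : HomTensorCard R G (R ⧸ Submodule.span R {a}) := by
  let f : G →ₗ[R] G := LinearMap.lsmul R G a
  let e1 : ((R ⧸ Submodule.span R {a}) →ₗ[R] G) ≃ f.ker :=
    { toFun := fun φ => ⟨φ (Submodule.Quotient.mk 1), by
        have : (Submodule.Quotient.mk a : R ⧸ Submodule.span R {a}) = 0 :=
          (Submodule.Quotient.mk_eq_zero _).2 (Submodule.mem_span_singleton_self a)
        rw [LinearMap.mem_ker]
        change a • φ _ = 0
        rw [← map_smul, ← Submodule.Quotient.mk_smul, smul_eq_mul, mul_one, this, map_zero]⟩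
      invFun := fun g => Submodule.liftQSpanSingleton a (LinearMap.toSpanSingleton R G g.1) (by
        have := g.2
        rw [LinearMap.mem_ker] at this
        exact this)
      left_inv := fun φ => by
        apply Submodule.linearMap_qext
        apply LinearMap.ext_ring
        change (1:R) • φ (Submodule.Quotient.mk 1) = φ (Submodule.Quotient.mk 1)
        rw [one_smul]
      right_inv := fun g => by
        apply Subtype.ext
        change (1:R) • g.1 = g.1
        rw [one_smul] }
  let e2 : ((R ⧸ Submodule.span R {a}) ⊗[R] G) ≃ (G ⧸ a • (⊤ : Submodule R G)) :=
    (QuotSMulTop.equivQuotTensor a G).symm.toEquiv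
  have hr : a • (⊤ : Submodule R G) = f.range := by
    ext x
    simp [f, Submodule.mem_smul_pointwise_iff_exists]
  have : Finite (G ⧸ a • (⊤ : Submodule R G)) := Quotient.finite _
  refine ⟨Finite.of_equiv _ e1.symm, Finite.of_equiv _ e2.symm, ?_⟩
  rw [Nat.card_congr e1, Nat.card_congr e2, hr]
  have k1 := Submodule.card_eq_card_quotient_mul_card f.ker
  have k2 := Submodule.card_eq_card_quotient_mul_card f.range
  rw [Nat.card_congr f.quotKerEquivRange.toEquiv, k2, mul_comm] at k1
  exact (Nat.eq_of_mul_eq_mul_right Nat.card_pos k1).symm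

end

/-- For every finitely generated abelian group `M` and every finite abelian group
`G`, the groups `Hom(M, G)` and `M ⊗_ℤ G` are finite and have the same
cardinality: `|Hom(M, G)| = |M ⊗_ℤ G|`. -/
theorem card_addHom_eq_card_tensor (M : Type) [AddCommGroup M] [AddGroup.FG M]
    (G : Type) [AddCommGroup G] [Finite G] :
    Finite (M →+ G) ∧ Finite (M ⊗[ℤ] G) ∧
      Nat.card (M →+ G) = Nat.card (M ⊗[ℤ] G) := by
  classical
  have : Module.Finite ℤ M := Module.Finite.iff_addGroup_fg.mpr inferInstance
  obtain ⟨n, ι, _, p, _, e, ⟨l⟩⟩ := Module.equiv_free_prod_directSum (R := ℤ) (M := M)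
  have h : HomTensorCard ℤ G M := by
    refine HomTensorCard.congr l.symm (HomTensorCard.prod ?_ ?_)
    · exact HomTensorCard.congr (Finsupp.linearEquivFunOnFinite ℤ ℤ (Fin n)).symm
        (HomTensorCard.pi fun _ => HomTensorCard.int)
    · exact HomTensorCard.congr (DirectSum.linearEquivFunOnFintype ℤ ι _).symm
        (HomTensorCard.pi fun i => HomTensorCard.cyclic (p i ^ e i))
  obtain ⟨h1, h2, h3⟩ := h
  let e0 : (M →+ G) ≃ (M →ₗ[ℤ] G) := (addMonoidHomLequivInt ℤ).toEquiv
  exact ⟨Finite.of_equiv _ e0.symm, h2, by rw [Nat.card_congr e0, h3]⟩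
end

section
/- (Theorem 1, homological core: splitting of boundaries across a bipartition.) Assume Im([i_{A∩B→A}; −i_{A∩B→B}]) ⊆ H_p(A;Ĝ) ⊕ H_p(B;Ĝ) is the graph of an isomorphism, i.e. there is a group isomorphism κ from Im(i_{A∩B→A}) onto Im(−i_{A∩B→B}) such that the image of the map [x] ↦ (i_{A∩B→A}[x], −i_{A∩B→B}[x]) equals {(a, κ(a)) : a ∈ Im(i_{A∩B→A})}. Then there exist functions f₁ : (Δ^p(A) → Ĝ) → C_{p+1}(Ĝ) with f₁(·) supported on Δ^{p+1}(A), and f₂ : (Δ^p ∖ Δ^p(A) → Ĝ) → C_{p+1}(Ĝ) with f₂(·) supported on Δ^{p+1}(B), such that for every boundary k ∈ B_p(X;Ĝ), writing k = k_A + k_{A^c} with k_A supported on Δ^p(A) and k_{A^c} supported on Δ^p ∖ Δ^p(A), one has ∂( f₁(k_A|_{Δ^p(A)}) + f₂(k_{A^c}|_{Δ^p ∖ Δ^p(A)}) ) = k. -/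
open Finset

set_option linter.unusedSectionVars false

noncomputable section

variable {G : Type} [AddCommGroup G]

variable {Δpm1 Δp Δp1 : Type} [Fintype Δpm1] [Fintype Δp] [Fintype Δp1]

/-- The group of `p`-cycles of the subcomplex with `p`-simplices `S0`: chains
supported on `S0` that are killed by the boundary map `∂'` induced by `s'`. -/
def Zsub (s' : Δp → Δpm1 → ℤ) (S0 : Set Δp) : AddSubgroup (Δp → PDual G) where
  carrier := {k | (∀ σ, σ ∉ S0 → k σ = 0) ∧ bd s' k = 0}
  add_mem' := by
    intro a b ha hb
    constructor
    · intro σ hσ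
      show a σ + b σ = 0
      rw [ha.1 σ hσ, hb.1 σ hσ, add_zero]
    · have h : bd s' (a + b) = bd s' a + bd s' b := by
        funext μ
        show (∑ σ, s' σ μ • (a σ + b σ)) = _
        simp [smul_add, Finset.sum_add_distrib, bd]
      rw [h, ha.2, hb.2, add_zero]
  zero_mem' := by
    constructor
    · intro σ _
      rfl
    · funext μ
      simp [bd]
  neg_mem' := by
    intro a ha
    constructor
    · intro σ hσ
      show -(a σ) = 0
      rw [ha.1 σ hσ, neg_zero]
    · have h : bd s' (-a) = -(bd s' a) := by
        funext μ
        show (∑ σ, s' σ μ • (-(a σ))) = -(∑ σ, s' σ μ • a σ)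
        simp [smul_neg, Finset.sum_neg_distrib]
      rw [h, ha.2, neg_zero]

/-- The group of `p`-boundaries of the subcomplex with `(p+1)`-simplices `S1`:
boundaries of `(p+1)`-chains supported on `S1`. -/
def Bsub (s : Δp1 → Δp → ℤ) (S1 : Set Δp1) : AddSubgroup (Δp → PDual G) where
  carrier := {k | ∃ k' : Δp1 → PDual G, (∀ τ, τ ∉ S1 → k' τ = 0) ∧ bd s k' = k}
  add_mem' := by
    rintro a b ⟨a', ha', rfl⟩ ⟨b', hb', rfl⟩
    refine ⟨a' + b', fun τ hτ => ?_, ?_⟩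
    · show a' τ + b' τ = 0
      rw [ha' τ hτ, hb' τ hτ, add_zero]
    · funext σ
      show (∑ τ, s τ σ • (a' τ + b' τ)) = _
      simp [smul_add, Finset.sum_add_distrib, bd]
  zero_mem' := by
    refine ⟨0, fun τ _ => rfl, ?_⟩
    funext σ
    simp [bd]
  neg_mem' := by
    rintro a ⟨a', ha', rfl⟩
    refine ⟨-a', fun τ hτ => ?_, ?_⟩
    · show -(a' τ) = 0
      rw [ha' τ hτ, neg_zero]
    · funext σ
      show (∑ τ, s τ σ • (-(a' τ))) = -(∑ τ, s τ σ • a' τ)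
      simp [smul_neg, Finset.sum_neg_distrib]

/-- The `p`-th homology group `H_p(Y;Ĝ) = (ker ∂ ∩ C_p(Y;Ĝ)) / ∂(C_{p+1}(Y;Ĝ))`
of the subcomplex `Y` with `(p+1)`-simplices `S1` and `p`-simplices `S0`. -/
abbrev Hgrp (s : Δp1 → Δp → ℤ) (s' : Δp → Δpm1 → ℤ) (S1 : Set Δp1) (S0 : Set Δp) : Type :=
  ↥(Zsub (G := G) s' S0) ⧸ ((Bsub (G := G) s S1).addSubgroupOf (Zsub (G := G) s' S0))

/-- The inclusion of cycle groups induced by an inclusion of subcomplexes. -/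
def inclZ (s' : Δp → Δpm1 → ℤ) {S0 S0' : Set Δp} (h0 : S0 ⊆ S0') :
    ↥(Zsub (G := G) s' S0) →+ ↥(Zsub (G := G) s' S0') :=
  AddMonoidHom.mk'
    (fun k => ⟨k.1, ⟨fun σ hσ => k.2.1 σ (fun hs => hσ (h0 hs)), k.2.2⟩⟩)
    (fun _ _ => rfl)

/-- The map on `p`-th homology induced by an inclusion of subcomplexes. -/
def inclH (s : Δp1 → Δp → ℤ) (s' : Δp → Δpm1 → ℤ) {S1 S1' : Set Δp1}
    {S0 S0' : Set Δp} (h1 : S1 ⊆ S1') (h0 : S0 ⊆ S0') :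
    Hgrp (G := G) s s' S1 S0 →+ Hgrp (G := G) s s' S1' S0' :=
  QuotientAddGroup.map _ _ (inclZ s' h0) (by
    rintro ⟨k, hk⟩ hmem
    rw [AddSubgroup.mem_addSubgroupOf] at hmem
    obtain ⟨k', hk', hbd⟩ := hmem
    rw [AddSubgroup.mem_comap, AddSubgroup.mem_addSubgroupOf]
    exact ⟨k', fun τ hτ => hk' τ (fun hs => hτ (h1 hs)), hbd⟩)

set_option maxHeartbeats 1000000

theorem split_aux {C : Type} [AddCommGroup C] (P : C →+ C) (hP : ∀ k, P (P k) = P k)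
    (BA BB B : AddSubgroup C) (hAB : ∀ k ∈ B, ∃ a ∈ BA, ∃ b ∈ BB, a + b = k)
    (h1 : ∀ k ∈ B, P k = k → k ∈ BA) (h2 : ∀ k ∈ B, P k = 0 → k ∈ BB) :
    ∃ g1 g2 : C → C, (∀ x, g1 x ∈ BA) ∧ (∀ x, g2 x ∈ BB) ∧
      ∀ k ∈ B, g1 (P k) + g2 (k - P k) = k := by
  classical
  let N : AddSubgroup C := B ⊓ B.comap P
  let rep : C → C := fun k => (QuotientAddGroup.mk k : C ⧸ N).out
  have hrep : ∀ k, k - rep k ∈ N := by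
    intro k
    have h : (QuotientAddGroup.mk (rep k) : C ⧸ N) = QuotientAddGroup.mk k :=
      Quotient.out_eq _
    have h' := QuotientAddGroup.eq.1 h
    rwa [neg_add_eq_sub] at h'
  have hrep_eq : ∀ k l, k - l ∈ N → rep k = rep l := by
    intro k l h
    have : (QuotientAddGroup.mk k : C ⧸ N) = QuotientAddGroup.mk l := by
      symm
      rw [QuotientAddGroup.eq, neg_add_eq_sub]
      exact h
    simp only [rep, this]
  have hrepB : ∀ k ∈ B, rep k ∈ B := by
    intro k hk
    have := B.sub_mem hk (hrep k).1
    simpa using this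
  choose! a ha b hb hab using hAB
  have hNA : ∀ n ∈ N, P n ∈ BA := fun n hn => h1 _ hn.2 (hP n)
  have hNB : ∀ n ∈ N, n - P n ∈ BB := fun n hn =>
    h2 _ (B.sub_mem hn.1 hn.2) (by rw [map_sub, hP, sub_self])
  have e1 : ∀ x : C, ∃ y ∈ BA, ∀ k ∈ B, P k = x → y = a (rep k) + (P (k - rep k)) := by
    intro x
    by_cases h : ∃ k ∈ B, P k = x
    · obtain ⟨k, hk, rfl⟩ := h
      refine ⟨_, BA.add_mem (ha _ (hrepB k hk)) (hNA _ (hrep k)), ?_⟩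
      intro l hl hlk
      have : rep k = rep l := hrep_eq _ _ ⟨B.sub_mem hk hl, by
        show P (k - l) ∈ B
        rw [map_sub, hlk, sub_self]; exact B.zero_mem⟩
      rw [this, map_sub, map_sub, hlk]
    · exact ⟨0, BA.zero_mem, fun k hk hkx => (h ⟨k, hk, hkx⟩).elim⟩
  have e2 : ∀ x : C, ∃ y ∈ BB, ∀ k ∈ B, k - P k = x →
      y = b (rep k) + ((k - rep k) - P (k - rep k)) := by
    intro x
    by_cases h : ∃ k ∈ B, k - P k = x
    · obtain ⟨k, hk, rfl⟩ := h
      refine ⟨_, BB.add_mem (hb _ (hrepB k hk)) (hNB _ (hrep k)), ?_⟩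
      intro l hl hlk
      have e : P (k - l) = k - l := by
        rw [map_sub]
        have : k - l - (P k - P l) = (k - P k) - (l - P l) := by abel
        rw [hlk, sub_self, sub_eq_zero] at this
        exact this.symm
      have : rep k = rep l := hrep_eq _ _ ⟨B.sub_mem hk hl, by
        show P (k - l) ∈ B
        rw [e]; exact B.sub_mem hk hl⟩
      rw [this]
      congr 1
      have : ∀ m, m - rep l - P (m - rep l) = (m - P m) - (rep l - P (rep l)) := by
        intro m; rw [map_sub]; abel
      rw [this, this, hlk]
    · exact ⟨0, BB.zero_mem, fun k hk hkx => (h ⟨k, hk, hkx⟩).elim⟩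
  choose g1 hg1 hg1' using e1
  choose g2 hg2 hg2' using e2
  refine ⟨g1, g2, hg1, hg2, fun k hk => ?_⟩
  rw [hg1' _ k hk rfl, hg2' _ k hk rfl]
  have := hab _ (hrepB k hk)
  calc _ = (a (rep k) + b (rep k)) + (k - rep k) := by abel
    _ = k := by rw [this]; abel

theorem bd_add_aux {G : Type} [AddCommGroup G] {A B : Type} [Fintype A] (s : A → B → ℤ)
    (x y : A → PDual G) : bd s (x + y) = bd s x + bd s y := by
  funext μ
  simp [bd, smul_add, Finset.sum_add_distrib]

theorem bd_bd_aux {G : Type} [AddCommGroup G] {A B C : Type} [Fintype A] [Fintype B]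
    (s : A → B → ℤ) (s' : B → C → ℤ) (h : ∀ τ μ, ∑ σ, s τ σ * s' σ μ = 0)
    (x : A → PDual G) : bd s' (bd s x) = 0 := by
  funext μ
  simp only [bd, Finset.smul_sum, Pi.zero_apply]
  rw [Finset.sum_comm]
  refine Finset.sum_eq_zero fun τ _ => ?_
  simp only [smul_smul]
  rw [← Finset.sum_smul]
  simp only [mul_comm (s' _ _)]
  rw [h, zero_smul]

theorem bd_supp_aux {G : Type} [AddCommGroup G] {A B : Type} [Fintype A] (s : A → B → ℤ)
    (S1 : Set A) (S0 : Set B) (h : ∀ τ ∈ S1, ∀ σ, s τ σ ≠ 0 → σ ∈ S0)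
    (k : B → PDual G) (hk : k ∈ Bsub (G := G) s S1) : ∀ σ, σ ∉ S0 → k σ = 0 := by
  obtain ⟨x, hx, rfl⟩ := hk
  intro σ hσ
  refine Finset.sum_eq_zero fun τ _ => ?_
  by_cases ht : τ ∈ S1
  · have : s τ σ = 0 := by
      by_contra h0
      exact hσ (h τ ht σ h0)
    rw [this, zero_smul]
  · rw [hx τ ht, smul_zero]

/-- **Theorem 1, homological core (splitting of boundaries across a
bipartition)**: if the image of `([i_{A∩B→A}; −i_{A∩B→B}])` in
`H_p(A;Ĝ) ⊕ H_p(B;Ĝ)` is the graph of an isomorphism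
`κ : Im(i_{A∩B→A}) ≅ Im(−i_{A∩B→B})`, then there exist `f₁` (with values
supported on `Δ^{p+1}(A)`) and `f₂` (with values supported on
`Δ^{p+1}(B) = Δ^{p+1} ∖ Δ^{p+1}(A)`) such that every boundary `k ∈ B_p(X;Ĝ)`
satisfies `∂(f₁(k|_{Δ^p(A)}) + f₂(k|_{Δ^p ∖ Δ^p(A)})) = k`. -/
theorem boundary_splitting_of_graph_iso {G : Type} [AddCommGroup G] [Fintype G]
    {Δpm1 Δp Δp1 : Type} [Fintype Δpm1] [Fintype Δp] [Fintype Δp1]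
    (s : Δp1 → Δp → ℤ) (s' : Δp → Δpm1 → ℤ)
    (hss' : ∀ τ μ, ∑ σ, s τ σ * s' σ μ = 0)
    -- the subcomplexes A and B (with Δ^{p+1}(B) = Δ^{p+1} ∖ Δ^{p+1}(A))
    (A1 : Set Δp1) (A0 : Set Δp) (Am : Set Δpm1)
    (B0 : Set Δp) (Bm : Set Δpm1)
    (hA10 : ∀ τ ∈ A1, ∀ σ, s τ σ ≠ 0 → σ ∈ A0)
    (hA0m : ∀ σ ∈ A0, ∀ μ, s' σ μ ≠ 0 → μ ∈ Am)
    (hB10 : ∀ τ ∈ A1ᶜ, ∀ σ, s τ σ ≠ 0 → σ ∈ B0)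
    (hB0m : ∀ σ ∈ B0, ∀ μ, s' σ μ ≠ 0 → μ ∈ Bm)
    (hcov0 : A0 ∪ B0 = Set.univ) (hcovm : Am ∪ Bm = Set.univ) :
    -- the maps on homology induced by the inclusions of A ∩ B into A and B
    let iA : Hgrp (G := G) s s' (A1 ∩ A1ᶜ) (A0 ∩ B0) →+ Hgrp (G := G) s s' A1 A0 :=
      inclH s s' Set.inter_subset_left Set.inter_subset_left
    let iB : Hgrp (G := G) s s' (A1 ∩ A1ᶜ) (A0 ∩ B0) →+ Hgrp (G := G) s s' A1ᶜ B0 :=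
      inclH s s' Set.inter_subset_right Set.inter_subset_right
    -- Mayer–Vietoris hypothesis: Im([iA; −iB]) is the graph of an isomorphism
    (∃ κ : ↥iA.range ≃+ ↥(-iB).range,
      ∀ x : Hgrp (G := G) s s' (A1 ∩ A1ᶜ) (A0 ∩ B0),
        ((κ ⟨iA x, AddMonoidHom.mem_range.mpr ⟨x, rfl⟩⟩ : ↥(-iB).range) :
            Hgrp (G := G) s s' A1ᶜ B0) = (-iB) x) →
    -- conclusion: the boundary group splits across the bipartition
    ∃ (f₁ : ({σ // σ ∈ A0} → PDual G) → (Δp1 → PDual G))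
      (f₂ : ({σ // σ ∉ A0} → PDual G) → (Δp1 → PDual G)),
      (∀ x τ, τ ∉ A1 → f₁ x τ = 0) ∧
      (∀ x τ, τ ∈ A1 → f₂ x τ = 0) ∧
      ∀ k ∈ Set.range (bd (G := G) s),
        bd s (f₁ (fun σ : {σ // σ ∈ A0} => k σ.1)
              + f₂ (fun σ : {σ // σ ∉ A0} => k σ.1)) = k := by
  classical
  intro iA iB ⟨κ, hκ⟩
  have hker : ∀ x, iA x = 0 ↔ iB x = 0 := by
    intro x
    have h := hκ x
    rw [AddMonoidHom.neg_apply] at h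
    constructor
    · intro hx
      have e : (⟨iA x, AddMonoidHom.mem_range.mpr ⟨x, rfl⟩⟩ : iA.range) = 0 := Subtype.ext hx
      rw [e, map_zero] at h
      exact neg_eq_zero.1 h.symm
    · intro hx
      rw [hx, neg_zero] at h
      have h2 := (map_eq_zero_iff κ κ.injective).1 (Subtype.ext h)
      exact congrArg Subtype.val h2
  have hcyc : ∀ z : Δp → PDual G, (∀ σ, σ ∉ A0 ∩ B0 → z σ = 0) → bd s' z = 0 →
      (z ∈ Bsub (G := G) s A1 ↔ z ∈ Bsub (G := G) s A1ᶜ) := by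
    intro z hz hz'
    have h := hker (QuotientAddGroup.mk ⟨z, hz, hz'⟩)
    have hA : iA (QuotientAddGroup.mk ⟨z, hz, hz'⟩) = 0 ↔ z ∈ Bsub (G := G) s A1 :=
      (QuotientAddGroup.eq_zero_iff _).trans AddSubgroup.mem_addSubgroupOf
    have hB : iB (QuotientAddGroup.mk ⟨z, hz, hz'⟩) = 0 ↔ z ∈ Bsub (G := G) s A1ᶜ :=
      (QuotientAddGroup.eq_zero_iff _).trans AddSubgroup.mem_addSubgroupOf
    rw [← hA, ← hB, h]
  have hcov : ∀ σ, σ ∉ A0 → σ ∈ B0 := by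
    intro σ hσ
    have : σ ∈ A0 ∪ B0 := hcov0 ▸ Set.mem_univ σ
    exact this.resolve_left hσ
  have hZ : ∀ S k, k ∈ Bsub (G := G) s S → bd s' k = 0 := by
    rintro S k ⟨x, _, rfl⟩
    exact bd_bd_aux s s' hss' x
  have hAB : ∀ k ∈ Bsub (G := G) s Set.univ,
      ∃ a ∈ Bsub (G := G) s A1, ∃ b ∈ Bsub (G := G) s A1ᶜ, a + b = k := by
    rintro k ⟨x, _, rfl⟩
    refine ⟨_, ⟨A1.indicator x, fun τ h => Set.indicator_of_notMem h _, rfl⟩,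
      _, ⟨A1ᶜ.indicator x, fun τ h => Set.indicator_of_notMem h _, rfl⟩, ?_⟩
    rw [← bd_add_aux, Set.indicator_self_add_compl]
  let P : (Δp → PDual G) →+ (Δp → PDual G) :=
    { toFun := fun k => A0.indicator k
      map_zero' := Set.indicator_zero _ _
      map_add' := fun x y => Set.indicator_add _ x y }
  have hPdef : ∀ k, P k = A0.indicator k := fun _ => rfl
  obtain ⟨g1, g2, hg1, hg2, hg⟩ := split_aux P
    (fun k => by simp [hPdef])
    (Bsub (G := G) s A1) (Bsub (G := G) s A1ᶜ) (Bsub (G := G) s Set.univ) hAB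
    (by
      intro k hk hPk
      obtain ⟨a, ha, b, hb, rfl⟩ := hAB k hk
      refine AddSubgroup.add_mem _ ha ((hcyc b ?_ (hZ _ _ hb)).2 hb)
      intro σ hσ
      by_cases h : σ ∈ B0
      · have hA : σ ∉ A0 := fun h' => hσ ⟨h', h⟩
        have e := congrFun hPk σ
        rw [hPdef, Set.indicator_of_notMem hA, Pi.add_apply,
          bd_supp_aux s A1 A0 hA10 a ha σ hA, zero_add] at e
        exact e.symm
      · exact bd_supp_aux s _ B0 hB10 b hb σ h)
    (by
      intro k hk hPk
      obtain ⟨a, ha, b, hb, rfl⟩ := hAB k hk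
      refine AddSubgroup.add_mem _ ((hcyc a ?_ (hZ _ _ ha)).1 ha) hb
      intro σ hσ
      by_cases h : σ ∈ A0
      · have hB : σ ∉ B0 := fun h' => hσ ⟨h, h'⟩
        have e := congrFun hPk σ
        rw [hPdef, Set.indicator_of_mem h, Pi.add_apply,
          bd_supp_aux s _ B0 hB10 b hb σ hB, add_zero] at e
        exact e
      · exact bd_supp_aux s _ A0 hA10 a ha σ h)
  choose c1 hc1 hc1' using hg1
  choose c2 hc2 hc2' using hg2
  refine ⟨fun x => c1 (fun σ => if h : σ ∈ A0 then x ⟨σ, h⟩ else 0),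
    fun y => c2 (fun σ => if h : σ ∉ A0 then y ⟨σ, h⟩ else 0),
    fun x τ h => hc1 _ τ h, fun x τ h => hc2 _ τ (fun h' => h' h), ?_⟩
  rintro k ⟨x, rfl⟩
  have hk := hg (bd s x) ⟨x, fun τ h => (h (Set.mem_univ τ)).elim, rfl⟩
  have e1 : (fun σ => if h : σ ∈ A0 then bd s x σ else 0) = P (bd s x) := by
    funext σ
    by_cases h : σ ∈ A0 <;> simp [hPdef, h]
  have e2 : (fun σ => if h : σ ∉ A0 then bd s x σ else 0) = bd s x - P (bd s x) := by
    funext σ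
    by_cases h : σ ∈ A0 <;> simp [hPdef, h]
  rw [bd_add_aux, hc1', hc2', e1, e2]
  exact hk
end
end
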